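/- arXiv:2307.05540 — 2 statements merged into one kernel-verified Lean document; each statement's English description precedes it below -/
import Mathlib

section
/- Let (X,r) be a finite non-degenerate set-theoretic solution of the Yang–Baxter equation. Then the structure skew brace G(X,r) is finitely presented as a skew brace. -/
universe u v

/-- A skew (left) brace: two group structures `(B,+)` and `(B,∘)` on the same set,
sharing the same identity element `zero` (recall that in any skew brace `0 = 1`),
satisfying the skew left distributive law `a ∘ (b + c) = a ∘ b - a + a ∘ c`. -/
structure SkewBrace (B : Type u) where
  add : B → B → B
  zero : B
  neg : B → B
  mul : B → B → B
  inv : B → B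
  add_assoc : ∀ a b c, add (add a b) c = add a (add b c)
  zero_add : ∀ a, add zero a = a
  add_zero : ∀ a, add a zero = a
  neg_add : ∀ a, add (neg a) a = zero
  add_neg : ∀ a, add a (neg a) = zero
  mul_assoc : ∀ a b c, mul (mul a b) c = mul a (mul b c)
  zero_mul : ∀ a, mul zero a = a
  mul_zero : ∀ a, mul a zero = a
  inv_mul : ∀ a, mul (inv a) a = zero
  mul_inv : ∀ a, mul a (inv a) = zero
  compat : ∀ a b c, mul a (add b c) = add (add (mul a b) (neg a)) (mul a c)

namespace SkewBrace

variable {B C Q : Type u}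

/-- `λ_a (b) = -a + a ∘ b`. -/
def lam (S : SkewBrace B) (a b : B) : B := S.add (S.neg a) (S.mul a b)

/-- `a ∗ b = λ_a(b) - b = -a + a ∘ b - b`. -/
def star (S : SkewBrace B) (a b : B) : B := S.add (S.lam a b) (S.neg b)

/-- A sub-skew brace: a subset containing the identity and closed under both group
operations and both inverses. -/
def IsSub (S : SkewBrace B) (T : Set B) : Prop :=
  S.zero ∈ T ∧ (∀ a ∈ T, ∀ b ∈ T, S.add a b ∈ T) ∧ (∀ a ∈ T, S.neg a ∈ T) ∧
    (∀ a ∈ T, ∀ b ∈ T, S.mul a b ∈ T) ∧ (∀ a ∈ T, S.inv a ∈ T)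

/-- The sub-skew brace generated by a subset. -/
def subGen (S : SkewBrace B) (X : Set B) : Set B := ⋂₀ {T | S.IsSub T ∧ X ⊆ T}

/-- A skew brace is finitely generated if a finite subset generates it. -/
def FinitelyGenerated (S : SkewBrace B) : Prop := ∃ T : Finset B, S.subGen ↑T = Set.univ

/-- A subgroup of the additive group `(B,+)`. -/
def IsAddSubgroup (S : SkewBrace B) (T : Set B) : Prop :=
  S.zero ∈ T ∧ (∀ a ∈ T, ∀ b ∈ T, S.add a b ∈ T) ∧ ∀ a ∈ T, S.neg a ∈ T

/-- A subgroup of the multiplicative group `(B,∘)`. -/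
def IsMulSubgroup (S : SkewBrace B) (T : Set B) : Prop :=
  S.zero ∈ T ∧ (∀ a ∈ T, ∀ b ∈ T, S.mul a b ∈ T) ∧ ∀ a ∈ T, S.inv a ∈ T

/-- The additive subgroup generated by a subset. -/
def addClosure (S : SkewBrace B) (X : Set B) : Set B := ⋂₀ {T | S.IsAddSubgroup T ∧ X ⊆ T}

/-- The multiplicative subgroup generated by a subset. -/
def mulClosure (S : SkewBrace B) (X : Set B) : Set B := ⋂₀ {T | S.IsMulSubgroup T ∧ X ⊆ T}

/-- The group `(B,+)` is finitely generated. -/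
def AddFG (S : SkewBrace B) : Prop := ∃ T : Finset B, S.addClosure ↑T = Set.univ

/-- The group `(B,∘)` is finitely generated. -/
def MulFG (S : SkewBrace B) : Prop := ∃ T : Finset B, S.mulClosure ↑T = Set.univ

/-- An ideal of a skew brace: a subgroup of `(B,+)`, normal in `(B,+)` and in `(B,∘)`,
invariant under all the maps `λ_b`. -/
def IsIdeal (S : SkewBrace B) (I : Set B) : Prop :=
  S.IsAddSubgroup I ∧ (∀ b : B, ∀ a ∈ I, S.add (S.add b a) (S.neg b) ∈ I) ∧
    (∀ b : B, ∀ a ∈ I, S.mul (S.mul b a) (S.inv b) ∈ I) ∧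
    ∀ b : B, ∀ a ∈ I, S.lam b a ∈ I

/-- The ideal generated by a subset (the smallest ideal containing it). -/
def idealGen (S : SkewBrace B) (X : Set B) : Set B := ⋂₀ {I | S.IsIdeal I ∧ X ⊆ I}

/-- A homomorphism of skew braces. -/
def IsHom (S : SkewBrace B) (T : SkewBrace C) (f : B → C) : Prop :=
  (∀ a b, f (S.add a b) = T.add (f a) (f b)) ∧ ∀ a b, f (S.mul a b) = T.mul (f a) (f b)

/-- `SF` together with `ι : X → F` is the free skew brace on `X`: every map from `X`
to a skew brace extends uniquely to a homomorphism. -/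
def IsFreeOn {F : Type u} {X : Type v} (SF : SkewBrace F) (ι : X → F) : Prop :=
  ∀ (C : Type u) (SC : SkewBrace C) (f : X → C),
    ∃! g : F → C, IsHom SF SC g ∧ ∀ x, g (ι x) = f x

/-- A skew brace is finitely presented if it is the image of a free skew brace on a
finite set under a homomorphism whose kernel is generated, as an ideal, by finitely
many elements. -/
def FinitelyPresented (S : SkewBrace B) : Prop :=
  ∃ (F : Type u) (SF : SkewBrace F) (m : ℕ) (ι : Fin m → F) (θ : F → B),
    IsFreeOn SF ι ∧ IsHom SF S θ ∧ Function.Surjective θ ∧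
      ∃ R : Finset F, {x | θ x = S.zero} = SF.idealGen ↑R

/-- `π : B → Q` realizes `Q` as the quotient skew brace `B/I`. -/
def IsQuotientBy (S : SkewBrace B) (I : Set B) (SQ : SkewBrace Q) (π : B → Q) : Prop :=
  IsHom S SQ π ∧ Function.Surjective π ∧ {x | π x = SQ.zero} = I

/-- The group `(B,+)` is finitely presented (as an abstract group). -/
def AddFP (S : SkewBrace B) : Prop :=
  ∃ (m : ℕ) (f : FreeGroup (Fin m) → B),
    (∀ x y, f (x * y) = S.add (f x) (f y)) ∧ Function.Surjective f ∧
      ∃ R : Finset (FreeGroup (Fin m)),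
        {x | f x = S.zero} = ↑(Subgroup.normalClosure (R : Set (FreeGroup (Fin m))))

/-- The group `(B,∘)` is finitely presented (as an abstract group). -/
def MulFP (S : SkewBrace B) : Prop :=
  ∃ (m : ℕ) (f : FreeGroup (Fin m) → B),
    (∀ x y, f (x * y) = S.mul (f x) (f y)) ∧ Function.Surjective f ∧
      ∃ R : Finset (FreeGroup (Fin m)),
        {x | f x = S.zero} = ↑(Subgroup.normalClosure (R : Set (FreeGroup (Fin m))))

/-- The ascending chain condition on sub-skew braces. -/
def SubACC (S : SkewBrace B) : Prop :=
  ∀ f : ℕ → Set B, Monotone f → (∀ n, S.IsSub (f n)) → ∃ n, ∀ m, n ≤ m → f m = f n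

/-- The ascending chain condition on subgroups of `(B,+)`. -/
def AddACC (S : SkewBrace B) : Prop :=
  ∀ f : ℕ → Set B, Monotone f → (∀ n, S.IsAddSubgroup (f n)) → ∃ n, ∀ m, n ≤ m → f m = f n

/-- The socle `Soc(B) = Ker(λ) ∩ Z(B,+)`. -/
def soc (S : SkewBrace B) : Set B :=
  {x | (∀ b, S.lam x b = b) ∧ ∀ b, S.add x b = S.add b x}

/-- The centre of the additive group `(B,+)`. -/
def addCenter (S : SkewBrace B) : Set B := {x | ∀ b, S.add x b = S.add b x}

/-- The preimage in `B` of `Ann(B/I)` (for `I` an ideal): the set of `x` such that,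
modulo `I`, `λ_x = id`, `x` is central in `(B,+)` and `x` is central in `(B,∘)`. -/
def annStep (S : SkewBrace B) (I : Set B) : Set B :=
  {x | (∀ b, S.add (S.lam x b) (S.neg b) ∈ I) ∧
       (∀ b, S.add (S.add x b) (S.neg (S.add b x)) ∈ I) ∧
       ∀ b, S.mul (S.mul x b) (S.inv (S.mul b x)) ∈ I}

/-- The preimage in `B` of `Soc(B/I)` (for `I` an ideal). -/
def socStep (S : SkewBrace B) (I : Set B) : Set B :=
  {x | (∀ b, S.add (S.lam x b) (S.neg b) ∈ I) ∧
       ∀ b, S.add (S.add x b) (S.neg (S.add b x)) ∈ I}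

/-- The upper annihilator series `Ann_α(B)`, defined by transfinite recursion. -/
noncomputable def annSeries (S : SkewBrace B) (o : Ordinal.{v}) : Set B :=
  Ordinal.limitRecOn o {S.zero} (fun _ ih => S.annStep ih)
    fun _o _ ih => ⋃ β, ⋃ h : β < _o, ih β h

/-- The upper socle series `Soc_α(B)`, defined by transfinite recursion. -/
noncomputable def socSeries (S : SkewBrace B) (o : Ordinal.{v}) : Set B :=
  Ordinal.limitRecOn o {S.zero} (fun _ ih => S.socStep ih)
    fun _o _ ih => ⋃ β, ⋃ h : β < _o, ih β h

/-- The solution of the YBE associated with a skew brace: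
`r_B(a,b) = (λ_a(b), λ_a(b)⁻¹ ∘ a ∘ b)`. -/
def braceR (S : SkewBrace B) : B × B → B × B :=
  fun p => (S.lam p.1 p.2, S.mul (S.inv (S.lam p.1 p.2)) (S.mul p.1 p.2))

end SkewBrace

/-- The set-theoretic Yang–Baxter (braid) equation
`(r × id)(id × r)(r × id) = (id × r)(r × id)(id × r)`. -/
def ybe {X : Type u} (r : X × X → X × X) : Prop :=
  let r₁ : X × X × X → X × X × X := fun p =>
    ((r (p.1, p.2.1)).1, (r (p.1, p.2.1)).2, p.2.2)
  let r₂ : X × X × X → X × X × X := fun p => (p.1, r p.2)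
  r₁ ∘ r₂ ∘ r₁ = r₂ ∘ r₁ ∘ r₂

/-- A non-degenerate set-theoretic solution: `r` is bijective, satisfies the YBE, and
writing `r (x,y) = (σ_x y, τ_y x)`, all maps `σ_x` and `τ_y` are bijective. -/
def IsNonDegenerateSolution {X : Type u} (r : X × X → X × X) : Prop :=
  Function.Bijective r ∧ ybe r ∧
    (∀ x, Function.Bijective fun y => (r (x, y)).1) ∧
    ∀ y, Function.Bijective fun x => (r (x, y)).2

/-- `S` (with the distinguished map `ι : X → B`) is the structure skew brace of the
solution `(X,r)`: the multiplicative group of `S` is the structure group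
`G(X,r) = ⟨X | x y = σ_x(y) τ_y(x)⟩` (expressed by the relations holding together
with the universal property of the presentation) and `r_S ∘ (ι × ι) = (ι × ι) ∘ r`. -/
def IsStructureSkewBrace {X B : Type u} (r : X × X → X × X)
    (S : SkewBrace B) (ι : X → B) : Prop :=
  (∀ x y, S.mul (ι x) (ι y) = S.mul (ι (r (x, y)).1) (ι (r (x, y)).2)) ∧
  (∀ (H : Type u) [Group H] (f : X → H),
      (∀ x y, f x * f y = f (r (x, y)).1 * f (r (x, y)).2) →
      ∃! φ : B → H, (∀ a b, φ (S.mul a b) = φ a * φ b) ∧ ∀ x, φ (ι x) = f x) ∧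
  ∀ x y, S.braceR (ι x, ι y) = (ι (r (x, y)).1, ι (r (x, y)).2)

namespace SkewBrace

section Basic

variable {B C : Type u} (S : SkewBrace B) (T : SkewBrace C)

/-- The multiplicative group of a skew brace. -/
abbrev toGroup : Group B :=
  letI : Mul B := ⟨S.mul⟩
  letI : One B := ⟨S.zero⟩
  letI : Inv B := ⟨S.inv⟩
  Group.ofLeftAxioms S.mul_assoc S.zero_mul S.inv_mul

lemma neg_add_cancel_left (a b : B) : S.add (S.neg a) (S.add a b) = b := by
  rw [← S.add_assoc, S.neg_add, S.zero_add]

lemma add_neg_cancel_left (a b : B) : S.add a (S.add (S.neg a) b) = b := by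
  rw [← S.add_assoc, S.add_neg, S.zero_add]

lemma add_left_cancel {a b c : B} (h : S.add a b = S.add a c) : b = c := by
  rw [← S.neg_add_cancel_left a b, h, S.neg_add_cancel_left]

lemma neg_eq_of_add_eq_zero {a b : B} (h : S.add a b = S.zero) : S.neg a = b :=
  S.add_left_cancel ((S.add_neg a).trans h.symm)

lemma neg_neg (a : B) : S.neg (S.neg a) = a :=
  S.neg_eq_of_add_eq_zero (S.neg_add a)

lemma neg_zero : S.neg S.zero = S.zero :=
  S.neg_eq_of_add_eq_zero (S.zero_add _)

lemma neg_add_rev (a b : B) : S.neg (S.add a b) = S.add (S.neg b) (S.neg a) :=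
  S.neg_eq_of_add_eq_zero (by rw [S.add_assoc, S.add_neg_cancel_left, S.add_neg])

lemma inv_mul_cancel_left (a b : B) : S.mul (S.inv a) (S.mul a b) = b := by
  rw [← S.mul_assoc, S.inv_mul, S.zero_mul]

lemma mul_inv_cancel_left (a b : B) : S.mul a (S.mul (S.inv a) b) = b := by
  rw [← S.mul_assoc, S.mul_inv, S.zero_mul]

lemma mul_left_cancel {a b c : B} (h : S.mul a b = S.mul a c) : b = c := by
  rw [← S.inv_mul_cancel_left a b, h, S.inv_mul_cancel_left]

lemma inv_eq_of_mul_eq_zero {a b : B} (h : S.mul a b = S.zero) : S.inv a = b :=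
  S.mul_left_cancel ((S.mul_inv a).trans h.symm)

lemma inv_inv (a : B) : S.inv (S.inv a) = a :=
  S.inv_eq_of_mul_eq_zero (S.inv_mul a)

lemma inv_zero : S.inv S.zero = S.zero :=
  S.inv_eq_of_mul_eq_zero (S.zero_mul _)

lemma mul_inv_rev (a b : B) : S.inv (S.mul a b) = S.mul (S.inv b) (S.inv a) :=
  S.inv_eq_of_mul_eq_zero (by rw [S.mul_assoc, S.mul_inv_cancel_left, S.mul_inv])

lemma mul_eq_add_lam (a b : B) : S.mul a b = S.add a (S.lam a b) :=
  (S.add_neg_cancel_left _ _).symm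

lemma lam_add (a b c : B) : S.lam a (S.add b c) = S.add (S.lam a b) (S.lam a c) := by
  simp only [lam, S.compat, S.add_assoc]

lemma lam_zero (a : B) : S.lam a S.zero = S.zero := by
  rw [lam, S.mul_zero, S.neg_add]

lemma lam_neg (a b : B) : S.lam a (S.neg b) = S.neg (S.lam a b) :=
  (S.neg_eq_of_add_eq_zero (by rw [← S.lam_add, S.add_neg, S.lam_zero])).symm

lemma zero_lam (a : B) : S.lam S.zero a = a := by
  rw [lam, S.neg_zero, S.zero_add, S.zero_mul]

lemma lam_mul (a b c : B) : S.lam (S.mul a b) c = S.lam a (S.lam b c) := by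
  apply S.add_left_cancel (a := S.mul a b)
  rw [← S.mul_eq_add_lam, S.mul_assoc, S.mul_eq_add_lam b c, S.mul_eq_add_lam a (S.add b _),
    S.lam_add, ← S.add_assoc, ← S.mul_eq_add_lam]

lemma lam_inv_lam (a b : B) : S.lam (S.inv a) (S.lam a b) = b := by
  rw [← S.lam_mul, S.inv_mul, S.zero_lam]

lemma lam_lam_inv (a b : B) : S.lam a (S.lam (S.inv a) b) = b := by
  rw [← S.lam_mul, S.mul_inv, S.zero_lam]

lemma add_eq_mul_lam_inv (a b : B) : S.add a b = S.mul a (S.lam (S.inv a) b) := by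
  rw [S.mul_eq_add_lam, S.lam_lam_inv]

lemma neg_inv (a : B) : S.neg (S.inv a) = S.lam (S.inv a) a :=
  S.neg_eq_of_add_eq_zero (by rw [← S.mul_eq_add_lam, S.inv_mul])

lemma inv_eq_neg_lam (a : B) : S.inv a = S.neg (S.lam (S.inv a) a) := by
  rw [← S.neg_inv, S.neg_neg]

variable {S T}

lemma IsHom.map_zero {f : B → C} (hf : IsHom S T f) : f S.zero = T.zero := by
  apply T.add_left_cancel (a := f S.zero)
  rw [← hf.1, S.zero_add, T.add_zero]

lemma IsHom.map_neg {f : B → C} (hf : IsHom S T f) (a : B) : f (S.neg a) = T.neg (f a) :=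
  (T.neg_eq_of_add_eq_zero (by rw [← hf.1, S.add_neg, hf.map_zero])).symm

lemma IsHom.map_inv {f : B → C} (hf : IsHom S T f) (a : B) : f (S.inv a) = T.inv (f a) :=
  (T.inv_eq_of_mul_eq_zero (by rw [← hf.2, S.mul_inv, hf.map_zero])).symm

lemma IsHom.map_lam {f : B → C} (hf : IsHom S T f) (a b : B) :
    f (S.lam a b) = T.lam (f a) (f b) := by
  rw [lam, lam, hf.1, hf.2, hf.map_neg]

lemma IsHom.isSub_preimage {f : B → C} (hf : IsHom S T f) {U : Set C} (hU : T.IsSub U) :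
    S.IsSub (f ⁻¹' U) := by
  obtain ⟨h0, ha, hn, hm, hi⟩ := hU
  simp only [IsSub, Set.mem_preimage, hf.map_zero, hf.map_neg, hf.map_inv, hf.1, hf.2]
  exact ⟨h0, fun a h b => ha _ h _, fun a => hn _, fun a h b => hm _ h _, fun a => hi _⟩

lemma IsHom.isIdeal_ker {f : B → C} (hf : IsHom S T f) : S.IsIdeal {x | f x = T.zero} := by
  refine ⟨⟨hf.map_zero, fun a ha b hb => ?_, fun a ha => ?_⟩, fun b a ha => ?_, fun b a ha => ?_,
    fun b a ha => ?_⟩ <;> simp only [Set.mem_ofPred_eq] at *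
  · rw [hf.1, ha, hb, T.zero_add]
  · rw [hf.map_neg, ha, T.neg_zero]
  · rw [hf.1, hf.1, hf.map_neg, ha, T.add_zero, T.add_neg]
  · rw [hf.2, hf.2, hf.map_inv, ha, T.mul_zero, T.mul_inv]
  · rw [hf.map_lam, ha, T.lam_zero]

end Basic

section Closure

variable {B : Type u} (S : SkewBrace B) (Y : Set B)

lemma isAddSubgroup_addClosure : S.IsAddSubgroup (S.addClosure Y) :=
  ⟨fun _ hT => hT.1.1, fun a ha b hb T hT => hT.1.2.1 a (ha T hT) b (hb T hT),
    fun a ha T hT => hT.1.2.2 a (ha T hT)⟩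

lemma subset_addClosure : Y ⊆ S.addClosure Y := fun _ hy _ hT => hT.2 hy

lemma isMulSubgroup_mulClosure : S.IsMulSubgroup (S.mulClosure Y) :=
  ⟨fun _ hT => hT.1.1, fun a ha b hb T hT => hT.1.2.1 a (ha T hT) b (hb T hT),
    fun a ha T hT => hT.1.2.2 a (ha T hT)⟩

lemma subset_mulClosure : Y ⊆ S.mulClosure Y := fun _ hy _ hT => hT.2 hy

lemma isIdeal_idealGen : S.IsIdeal (S.idealGen Y) :=
  ⟨⟨fun _ hT => hT.1.1.1, fun a ha b hb T hT => hT.1.1.2.1 a (ha T hT) b (hb T hT),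
      fun a ha T hT => hT.1.1.2.2 a (ha T hT)⟩,
    fun b a ha T hT => hT.1.2.1 b a (ha T hT), fun b a ha T hT => hT.1.2.2.1 b a (ha T hT),
    fun b a ha T hT => hT.1.2.2.2 b a (ha T hT)⟩

lemma subset_idealGen : Y ⊆ S.idealGen Y := fun _ hy _ hT => hT.2 hy

variable {S Y}

/-- If the multiplicative subgroup generated by a finite set `Y` acts on `Y` through `λ`,
then it is a sub-skew brace. -/
lemma isSub_mulClosure (hY : Y.Finite) (h : ∀ a ∈ Y, ∀ b ∈ Y, S.lam a b ∈ Y)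
    (h' : ∀ a ∈ Y, ∀ b ∈ Y, S.lam (S.inv a) b ∈ Y) : S.IsSub (S.mulClosure Y) := by
  have hM := S.isMulSubgroup_mulClosure Y
  have hA := S.isAddSubgroup_addClosure Y
  have hMY := S.subset_mulClosure Y
  have hAY := S.subset_addClosure Y
  have hact : ∀ m ∈ S.mulClosure Y, ∀ y ∈ Y, S.lam m y ∈ Y := by
    intro m hm
    refine (hm {m | (∀ y ∈ Y, S.lam m y ∈ Y) ∧ ∀ y ∈ Y, S.lam (S.inv m) y ∈ Y}
      ⟨⟨?_, ?_, ?_⟩, fun a ha => ⟨h a ha, h' a ha⟩⟩).1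
    · simp [S.inv_zero, S.zero_lam]
    · rintro a ⟨ha, ha'⟩ b ⟨hb, hb'⟩
      refine ⟨fun y hy => ?_, fun y hy => ?_⟩
      · rw [S.lam_mul]
        exact ha _ (hb _ hy)
      · rw [S.mul_inv_rev, S.lam_mul]
        exact hb' _ (ha' _ hy)
    · rintro a ⟨ha, ha'⟩
      exact ⟨ha', by rwa [S.inv_inv]⟩
  have hactA : ∀ m ∈ S.mulClosure Y, ∀ a ∈ S.addClosure Y, S.lam m a ∈ S.addClosure Y := by
    intro m hm a ha
    refine ha {a | S.lam m a ∈ S.addClosure Y}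
      ⟨⟨?_, fun a ha b hb => ?_, fun a ha => ?_⟩, fun y hy => hAY (hact m hm y hy)⟩
    · rw [Set.mem_ofPred_eq, S.lam_zero]
      exact hA.1
    · rw [Set.mem_ofPred_eq, S.lam_add]
      exact hA.2.1 _ ha _ hb
    · rw [Set.mem_ofPred_eq, S.lam_neg]
      exact hA.2.2 _ ha
  have hle : S.mulClosure Y ⊆ S.addClosure Y := by
    intro m hm
    refine (hm (S.mulClosure Y ∩ S.addClosure Y)
      ⟨⟨⟨hM.1, hA.1⟩, ?_, ?_⟩, fun y hy => ⟨hMY hy, hAY hy⟩⟩).2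
    · rintro a ⟨ha, ha'⟩ b ⟨hb, hb'⟩
      refine ⟨hM.2.1 _ ha _ hb, ?_⟩
      rw [S.mul_eq_add_lam]
      exact hA.2.1 _ ha' _ (hactA _ ha _ hb')
    · rintro a ⟨ha, ha'⟩
      refine ⟨hM.2.2 _ ha, ?_⟩
      rw [S.inv_eq_neg_lam]
      exact hA.2.2 _ (hactA _ (hM.2.2 _ ha) _ ha')
  have hneg : ∀ y ∈ Y, S.neg y ∈ S.mulClosure Y := by
    intro y hy
    let d : Y → Y := fun a => ⟨S.neg (S.inv a), by
      rw [S.neg_inv]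
      exact h' a a.2 a a.2⟩
    have : Finite Y := hY
    have hd : Function.Injective d := by
      intro a b hab
      have hab' : S.neg (S.inv a) = S.neg (S.inv b) := congrArg Subtype.val hab
      apply Subtype.ext
      rw [← S.inv_inv a, ← S.neg_neg (S.inv a), hab', S.neg_neg, S.inv_inv]
    obtain ⟨a, ha⟩ := Finite.surjective_of_injective hd ⟨y, hy⟩
    have ha' : S.neg (S.inv a) = y := congrArg Subtype.val ha
    rw [← ha', S.neg_neg]
    exact hM.2.2 _ (hMY a.2)
  have hright : ∀ a ∈ S.addClosure Y, ∀ m ∈ S.mulClosure Y,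
      S.add m a ∈ S.mulClosure Y ∧ S.add m (S.neg a) ∈ S.mulClosure Y := by
    intro a ha
    refine ha {a | ∀ m ∈ S.mulClosure Y,
      S.add m a ∈ S.mulClosure Y ∧ S.add m (S.neg a) ∈ S.mulClosure Y}
      ⟨⟨fun m hm => ?_, fun a ha b hb m hm => ⟨?_, ?_⟩, fun a ha m hm => ?_⟩,
        fun y hy m hm => ⟨?_, ?_⟩⟩
    · rw [S.neg_zero, S.add_zero]
      exact ⟨hm, hm⟩
    · rw [← S.add_assoc]
      exact (hb _ (ha m hm).1).1
    · rw [S.neg_add_rev, ← S.add_assoc]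
      exact (ha _ (hb m hm).2).2
    · rw [S.neg_neg]
      exact (ha m hm).symm
    · rw [S.add_eq_mul_lam_inv]
      exact hM.2.1 _ hm _ (hMY (hact _ (hM.2.2 _ hm) y hy))
    · rw [S.add_eq_mul_lam_inv, S.lam_neg]
      exact hM.2.1 _ hm _ (hneg _ (hact _ (hM.2.2 _ hm) y hy))
  refine ⟨hM.1, fun a ha b hb => (hright b (hle hb) a ha).1, fun a ha => ?_, hM.2.1, hM.2.2⟩
  have := (hright a (hle ha) _ hM.1).2
  rwa [S.zero_add] at this

end Closure

section Quotient

variable {B : Type u} {S : SkewBrace B} {I : Set B}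

lemma IsIdeal.mul_mem (hI : S.IsIdeal I) {a b : B} (ha : a ∈ I) (hb : b ∈ I) :
    S.mul a b ∈ I := by
  rw [S.mul_eq_add_lam]
  exact hI.1.2.1 _ ha _ (hI.2.2.2 _ _ hb)

lemma IsIdeal.inv_mem (hI : S.IsIdeal I) {a : B} (ha : a ∈ I) : S.inv a ∈ I := by
  rw [S.inv_eq_neg_lam]
  exact hI.1.2.2 _ (hI.2.2.2 _ _ ha)

/-- Congruence modulo an ideal. -/
abbrev IsIdeal.setoid (hI : S.IsIdeal I) : Setoid B where
  r a b := S.add (S.neg a) b ∈ I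
  iseqv :=
    { refl := fun a => by
        rw [S.neg_add]
        exact hI.1.1
      symm := fun {a b} h => by
        have := hI.1.2.2 _ h
        rwa [S.neg_add_rev, S.neg_neg] at this
      trans := fun {a b c} h k => by
        have := hI.1.2.1 _ h _ k
        rwa [S.add_assoc, S.add_neg_cancel_left] at this }

lemma IsIdeal.rel_iff_mul (hI : S.IsIdeal I) (a b : B) :
    hI.setoid.r a b ↔ S.mul (S.inv a) b ∈ I := by
  have key : S.add (S.neg a) b = S.lam a (S.mul (S.inv a) b) := by
    rw [lam, S.mul_inv_cancel_left]
  change S.add (S.neg a) b ∈ I ↔ _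
  rw [key]
  refine ⟨fun h => ?_, fun h => hI.2.2.2 _ _ h⟩
  have := hI.2.2.2 (S.inv a) _ h
  rwa [S.lam_inv_lam] at this

lemma IsIdeal.rel_add (hI : S.IsIdeal I) {a a' b b' : B} (h : hI.setoid.r a a')
    (k : hI.setoid.r b b') : hI.setoid.r (S.add a b) (S.add a' b') := by
  change S.add (S.neg (S.add a b)) (S.add a' b') ∈ I
  have h1 := hI.2.1 (S.neg b) _ h
  have h2 := hI.1.2.1 _ h1 _ k
  simpa only [S.neg_add_rev, S.neg_neg, S.add_assoc, S.add_neg_cancel_left] using h2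

lemma IsIdeal.rel_mul (hI : S.IsIdeal I) {a a' b b' : B} (h : hI.setoid.r a a')
    (k : hI.setoid.r b b') : hI.setoid.r (S.mul a b) (S.mul a' b') := by
  rw [hI.rel_iff_mul] at *
  have h1 := hI.2.2.1 (S.inv b) _ h
  have h2 := hI.mul_mem h1 k
  simpa only [S.mul_inv_rev, S.inv_inv, S.mul_assoc, S.mul_inv_cancel_left] using h2

lemma IsIdeal.rel_neg (hI : S.IsIdeal I) {a a' : B} (h : hI.setoid.r a a') :
    hI.setoid.r (S.neg a) (S.neg a') := by
  change S.add (S.neg (S.neg a)) (S.neg a') ∈ I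
  have h1 := hI.2.1 a _ (hI.1.2.2 _ h)
  simpa only [S.neg_add_rev, S.neg_neg, S.add_assoc, S.add_neg, S.add_neg_cancel_left,
    S.add_zero] using h1

lemma IsIdeal.rel_inv (hI : S.IsIdeal I) {a a' : B} (h : hI.setoid.r a a') :
    hI.setoid.r (S.inv a) (S.inv a') := by
  rw [hI.rel_iff_mul] at *
  have h1 := hI.2.2.1 a _ (hI.inv_mem h)
  simpa only [S.mul_inv_rev, S.inv_inv, S.mul_assoc, S.mul_inv, S.mul_inv_cancel_left,
    S.mul_zero] using h1

/-- The quotient of a skew brace by an ideal. -/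
def IsIdeal.quotient (hI : S.IsIdeal I) : SkewBrace (Quotient hI.setoid) where
  add := Quotient.map₂ S.add fun _ _ h _ _ k => hI.rel_add h k
  zero := Quotient.mk _ S.zero
  neg := Quotient.map S.neg fun _ _ h => hI.rel_neg h
  mul := Quotient.map₂ S.mul fun _ _ h _ _ k => hI.rel_mul h k
  inv := Quotient.map S.inv fun _ _ h => hI.rel_inv h
  add_assoc := by
    rintro ⟨a⟩ ⟨b⟩ ⟨c⟩
    exact congrArg (Quotient.mk _) (S.add_assoc a b c)
  zero_add := by
    rintro ⟨a⟩
    exact congrArg (Quotient.mk _) (S.zero_add a)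
  add_zero := by
    rintro ⟨a⟩
    exact congrArg (Quotient.mk _) (S.add_zero a)
  neg_add := by
    rintro ⟨a⟩
    exact congrArg (Quotient.mk _) (S.neg_add a)
  add_neg := by
    rintro ⟨a⟩
    exact congrArg (Quotient.mk _) (S.add_neg a)
  mul_assoc := by
    rintro ⟨a⟩ ⟨b⟩ ⟨c⟩
    exact congrArg (Quotient.mk _) (S.mul_assoc a b c)
  zero_mul := by
    rintro ⟨a⟩
    exact congrArg (Quotient.mk _) (S.zero_mul a)
  mul_zero := by
    rintro ⟨a⟩
    exact congrArg (Quotient.mk _) (S.mul_zero a)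
  inv_mul := by
    rintro ⟨a⟩
    exact congrArg (Quotient.mk _) (S.inv_mul a)
  mul_inv := by
    rintro ⟨a⟩
    exact congrArg (Quotient.mk _) (S.mul_inv a)
  compat := by
    rintro ⟨a⟩ ⟨b⟩ ⟨c⟩
    exact congrArg (Quotient.mk _) (S.compat a b c)

lemma IsIdeal.isHom_mk (hI : S.IsIdeal I) : IsHom S hI.quotient (Quotient.mk hI.setoid) :=
  ⟨fun _ _ => rfl, fun _ _ => rfl⟩

lemma IsIdeal.mk_eq_zero_iff (hI : S.IsIdeal I) (a : B) :
    Quotient.mk hI.setoid a = hI.quotient.zero ↔ a ∈ I := by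
  rw [eq_comm]
  refine Quotient.eq.trans ?_
  change S.add (S.neg S.zero) a ∈ I ↔ _
  rw [S.neg_zero, S.zero_add]

end Quotient

/-- Formal skew brace expressions in variables from `X`. -/
inductive FreeTerm (X : Type u) : Type u
  | of (x : X)
  | add (s t : FreeTerm X)
  | zero
  | neg (s : FreeTerm X)
  | mul (s t : FreeTerm X)
  | inv (s : FreeTerm X)

section Free

variable {X C : Type u}

/-- The value of a formal expression in a skew brace. -/
def FreeTerm.eval (S : SkewBrace C) (f : X → C) : FreeTerm X → C
  | of x => f x
  | add s t => S.add (s.eval S f) (t.eval S f)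
  | zero => S.zero
  | neg s => S.neg (s.eval S f)
  | mul s t => S.mul (s.eval S f) (t.eval S f)
  | inv s => S.inv (s.eval S f)

/-- Two formal expressions are identified when they agree in every skew brace. -/
instance FreeTerm.setoid (X : Type u) : Setoid (FreeTerm X) where
  r s t := ∀ (C : Type u) (S : SkewBrace C) (f : X → C), s.eval S f = t.eval S f
  iseqv :=
    { refl := fun _ _ _ _ => rfl
      symm := fun h C S f => (h C S f).symm
      trans := fun h k C S f => (h C S f).trans (k C S f) }

/-- The carrier of the free skew brace on `X`. -/
abbrev FreeCarrier (X : Type u) : Type u := Quotient (FreeTerm.setoid X)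

/-- The free skew brace on `X`. -/
def free (X : Type u) : SkewBrace (FreeCarrier X) where
  add := Quotient.map₂ .add fun _ _ h _ _ k C S f =>
    congrArg₂ S.add (h C S f) (k C S f)
  zero := Quotient.mk _ .zero
  neg := Quotient.map .neg fun _ _ h C S f => congrArg S.neg (h C S f)
  mul := Quotient.map₂ .mul fun _ _ h _ _ k C S f =>
    congrArg₂ S.mul (h C S f) (k C S f)
  inv := Quotient.map .inv fun _ _ h C S f => congrArg S.inv (h C S f)
  add_assoc := by
    rintro ⟨a⟩ ⟨b⟩ ⟨c⟩
    exact Quotient.sound fun C S f => S.add_assoc _ _ _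
  zero_add := by
    rintro ⟨a⟩
    exact Quotient.sound fun C S f => S.zero_add _
  add_zero := by
    rintro ⟨a⟩
    exact Quotient.sound fun C S f => S.add_zero _
  neg_add := by
    rintro ⟨a⟩
    exact Quotient.sound fun C S f => S.neg_add _
  add_neg := by
    rintro ⟨a⟩
    exact Quotient.sound fun C S f => S.add_neg _
  mul_assoc := by
    rintro ⟨a⟩ ⟨b⟩ ⟨c⟩
    exact Quotient.sound fun C S f => S.mul_assoc _ _ _
  zero_mul := by
    rintro ⟨a⟩
    exact Quotient.sound fun C S f => S.zero_mul _
  mul_zero := by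
    rintro ⟨a⟩
    exact Quotient.sound fun C S f => S.mul_zero _
  inv_mul := by
    rintro ⟨a⟩
    exact Quotient.sound fun C S f => S.inv_mul _
  mul_inv := by
    rintro ⟨a⟩
    exact Quotient.sound fun C S f => S.mul_inv _
  compat := by
    rintro ⟨a⟩ ⟨b⟩ ⟨c⟩
    exact Quotient.sound fun C S f => S.compat _ _ _

/-- The generators of the free skew brace. -/
def freeOf (x : X) : FreeCarrier X := Quotient.mk _ (.of x)

/-- The homomorphism from the free skew brace extending a map on generators. -/
def freeLift (S : SkewBrace C) (f : X → C) : FreeCarrier X → C :=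
  Quotient.lift (fun t => t.eval S f) fun _ _ h => h C S f

lemma isHom_freeLift (S : SkewBrace C) (f : X → C) : IsHom (free X) S (freeLift S f) := by
  constructor <;> rintro ⟨a⟩ ⟨b⟩ <;> rfl

lemma mem_of_isSub_free {U : Set (FreeCarrier X)} (hU : (free X).IsSub U)
    (hX : ∀ x, freeOf x ∈ U) (a : FreeCarrier X) : a ∈ U := by
  obtain ⟨t, rfl⟩ := Quotient.mk_surjective a
  induction t with
  | of x => exact hX x
  | add s t hs ht => exact hU.2.1 _ hs _ ht
  | zero => exact hU.1
  | neg s hs => exact hU.2.2.1 _ hs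
  | mul s t hs ht => exact hU.2.2.2.1 _ hs _ ht
  | inv s hs => exact hU.2.2.2.2 _ hs

lemma isSub_eqLocus {B : Type u} {S : SkewBrace B} {T : SkewBrace C} {f g : B → C}
    (hf : IsHom S T f) (hg : IsHom S T g) : S.IsSub {x | f x = g x} := by
  refine ⟨hf.map_zero.trans hg.map_zero.symm, fun a ha b hb => ?_, fun a ha => ?_,
    fun a ha b hb => ?_, fun a ha => ?_⟩ <;> simp only [Set.mem_ofPred_eq] at *
  · rw [hf.1, hg.1, ha, hb]
  · rw [hf.map_neg, hg.map_neg, ha]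
  · rw [hf.2, hg.2, ha, hb]
  · rw [hf.map_inv, hg.map_inv, ha]

lemma isFreeOn_free {Y : Type v} (e : Y ≃ X) :
    IsFreeOn (free X) fun y => freeOf (e y) := by
  intro C SC f
  refine ⟨freeLift SC (f ∘ e.symm), ⟨isHom_freeLift _ _, fun y => ?_⟩, fun g hg => ?_⟩
  · exact congrArg f (e.symm_apply_apply y)
  · funext a
    refine mem_of_isSub_free (isSub_eqLocus hg.1 (isHom_freeLift SC (f ∘ e.symm)))
      (fun x => ?_) a
    have := hg.2 (e.symm x)
    simp only [e.apply_symm_apply] at this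
    exact this

end Free

end SkewBrace

/-- **Main Theorem.** Let `(X,r)` be a finite non-degenerate set-theoretic solution of
the Yang–Baxter equation. Then the structure skew brace `G(X,r)` is finitely
presented as a skew brace. -/
theorem structure_skew_brace_finitely_presented {X B : Type u} [Finite X]
    (r : X × X → X × X) (hsol : IsNonDegenerateSolution r)
    (S : SkewBrace B) (ι : X → B) (hstr : IsStructureSkewBrace r S ι) :
    S.FinitelyPresented := by
  classical
  obtain ⟨hrel, huniv, hbr⟩ := hstr
  let F := SkewBrace.free X
  let θ := SkewBrace.freeLift S ι
  have hθ : SkewBrace.IsHom F S θ := SkewBrace.isHom_freeLift S ι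
  have hθι : ∀ x, θ (SkewBrace.freeOf x) = ι x := fun _ => rfl
  let g : X → SkewBrace.FreeCarrier X := SkewBrace.freeOf
  let lamRel : X × X → SkewBrace.FreeCarrier X := fun p =>
    F.add (F.neg (F.lam (g p.1) (g p.2))) (g (r p).1)
  let mulRel : X × X → SkewBrace.FreeCarrier X := fun p =>
    F.add (F.neg (F.mul (g p.1) (g p.2))) (F.mul (g (r p).1) (g (r p).2))
  have hfin : (Set.range lamRel ∪ Set.range mulRel).Finite :=
    (Set.finite_range _).union (Set.finite_range _)
  set R := Set.range lamRel ∪ Set.range mulRel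
  have hker : F.idealGen R ⊆ {x | θ x = S.zero} := by
    refine Set.sInter_subset_of_mem ⟨hθ.isIdeal_ker, ?_⟩
    rintro _ (⟨p, rfl⟩ | ⟨p, rfl⟩) <;> simp only [lamRel, mulRel, Set.mem_ofPred_eq]
    · have := congrArg Prod.fst (hbr p.1 p.2)
      rw [hθ.1, hθ.map_neg, hθ.map_lam, hθι, hθι, hθι]
      change S.lam (ι p.1) (ι p.2) = ι (r p).1 at this
      rw [this, S.neg_add]
    · rw [hθ.1, hθ.map_neg, hθ.2, hθ.2, hθι, hθι, hθι, hθι, hrel p.1 p.2, S.neg_add]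
  have hI := F.isIdeal_idealGen R
  let Q := hI.quotient
  let π := Quotient.mk hI.setoid
  have hπ : SkewBrace.IsHom F Q π := hI.isHom_mk
  let θQ : Quotient hI.setoid → B := Quotient.lift θ fun a b h => by
    have h' : θ (F.add (F.neg a) b) = S.zero := hker h
    rw [hθ.1, hθ.map_neg] at h'
    exact S.add_left_cancel ((S.neg_add _).trans h'.symm)
  have hθQ : SkewBrace.IsHom Q S θQ := by
    constructor <;> rintro ⟨a⟩ ⟨b⟩
    · exact hθ.1 a b
    · exact hθ.2 a b
  have hlam : ∀ x y, Q.lam (π (g x)) (π (g y)) = π (g (r (x, y)).1) := fun x y =>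
    Quotient.sound (F.subset_idealGen R (Or.inl ⟨(x, y), rfl⟩))
  have hmul : ∀ x y, Q.mul (π (g x)) (π (g y)) =
      Q.mul (π (g (r (x, y)).1)) (π (g (r (x, y)).2)) := fun x y =>
    Quotient.sound (F.subset_idealGen R (Or.inr ⟨(x, y), rfl⟩))
  have hgen : ∀ q, q ∈ Q.mulClosure (Set.range (π ∘ g)) := by
    have hsub : Q.IsSub (Q.mulClosure (Set.range (π ∘ g))) := by
      apply SkewBrace.isSub_mulClosure (Set.finite_range _)
      · rintro _ ⟨x, rfl⟩ _ ⟨y, rfl⟩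
        exact ⟨_, (hlam x y).symm⟩
      · rintro _ ⟨x, rfl⟩ _ ⟨y, rfl⟩
        obtain ⟨z, hz⟩ := (hsol.2.2.1 x).2 y
        refine ⟨z, ?_⟩
        have := hlam x z
        simp only at hz
        rw [hz] at this
        simp only [Function.comp_apply]
        rw [← this, Q.lam_inv_lam]
    intro q
    obtain ⟨a, rfl⟩ := Quotient.mk_surjective q
    exact SkewBrace.mem_of_isSub_free (hπ.isSub_preimage hsub)
      (fun x => Q.subset_mulClosure _ ⟨x, rfl⟩) a
  obtain ⟨ψ, ⟨hψ, hψι⟩, -⟩ :=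
    @huniv (Quotient hI.setoid) Q.toGroup (π ∘ g) hmul
  replace hψ : ∀ a b, ψ (S.mul a b) = Q.mul (ψ a) (ψ b) := hψ
  have hright : ∀ b, θQ (ψ b) = b := by
    refine congrFun ((@huniv B S.toGroup ι hrel).unique (y₁ := θQ ∘ ψ) (y₂ := id) ⟨fun a b => ?_,
      fun x => ?_⟩ ⟨fun a b => rfl, fun x => rfl⟩)
    · simp only [Function.comp_apply]
      rw [hψ]
      exact hθQ.2 _ _
    · simp only [Function.comp_apply]
      rw [hψι]
      rfl
  have hψ0 : ψ S.zero = Q.zero := by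
    apply Q.mul_left_cancel (a := ψ S.zero)
    rw [← hψ, S.zero_mul, Q.mul_zero]
  have hψinv : ∀ a, ψ (S.inv a) = Q.inv (ψ a) := fun a =>
    (Q.inv_eq_of_mul_eq_zero (by rw [← hψ, S.mul_inv, hψ0])).symm
  have hleft : ∀ q, ψ (θQ q) = q := by
    intro q
    refine hgen q {q | ψ (θQ q) = q} ⟨⟨?_, fun a ha b hb => ?_, fun a ha => ?_⟩, ?_⟩
    · rw [Set.mem_ofPred_eq, hθQ.map_zero, hψ0]
    · rw [Set.mem_ofPred_eq] at *
      rw [hθQ.2, hψ, ha, hb]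
    · rw [Set.mem_ofPred_eq] at *
      rw [hθQ.map_inv, hψinv, ha]
    · rintro _ ⟨x, rfl⟩
      exact hψι x
  let e := Finite.equivFin X
  refine ⟨_, F, Nat.card X, _, θ, SkewBrace.isFreeOn_free e.symm, hθ, fun b => ?_,
    hfin.toFinset, ?_⟩
  · obtain ⟨a, ha⟩ := Quotient.mk_surjective (ψ b)
    refine ⟨a, ?_⟩
    rw [← hright b, ← ha]
    rfl
  · rw [Set.Finite.coe_toFinset]
    refine Set.Subset.antisymm (fun a ha => ?_) hker
    rw [← hI.mk_eq_zero_iff]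
    change θQ (π a) = S.zero at ha
    have := hleft (π a)
    rw [ha, hψ0] at this
    exact this.symm
end

section
/- Let B be an annihilator hypercentral skew brace. Then every finitely generated sub-skew brace of B satisfies ACC (the ascending chain condition on sub-skew braces). -/
universe u v

namespace Subgroup

variable {G : Type*} [Group G]

/-- The pairs of congruent elements modulo `K` in the normalizer of `K`. -/
@[to_additive]
def congrMod (K : Subgroup G) : Subgroup (G × G) where
  carrier := {p | p.2 ∈ normalizer (K : Set G) ∧ p.1 * p.2⁻¹ ∈ K}
  one_mem' := ⟨one_mem _, by simp [K.one_mem]⟩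
  mul_mem' := by
    rintro ⟨a, y⟩ ⟨b, z⟩ ⟨hy, ha⟩ ⟨hz, hb⟩
    refine ⟨mul_mem hy hz, ?_⟩
    have h := K.mul_mem ha ((mem_normalizer_iff.1 hy _).1 hb)
    simpa [mul_assoc] using h
  inv_mem' := by
    rintro ⟨a, y⟩ ⟨hy, ha⟩
    refine ⟨inv_mem hy, ?_⟩
    have h := (mem_normalizer_iff''.1 hy _).1 (K.inv_mem ha)
    simpa [mul_assoc] using h

/-- The product of a subgroup with the cyclic subgroup generated by an element of its
normalizer. -/
@[to_additive]
def extendBy (K : Subgroup G) {x : G} (hx : x ∈ normalizer (K : Set G)) : Subgroup G where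
  carrier := {a | ∃ n : ℤ, a * (x ^ n)⁻¹ ∈ K}
  one_mem' := ⟨0, by simp [K.one_mem]⟩
  mul_mem' := by
    rintro a b ⟨n, hn⟩ ⟨m, hm⟩
    refine ⟨n + m, ?_⟩
    have ha : (a, x ^ n) ∈ K.congrMod := ⟨zpow_mem hx n, hn⟩
    have hb : (b, x ^ m) ∈ K.congrMod := ⟨zpow_mem hx m, hm⟩
    rw [zpow_add]
    exact (mul_mem ha hb).2
  inv_mem' := by
    rintro a ⟨n, hn⟩
    refine ⟨-n, ?_⟩
    have ha : (a, x ^ n) ∈ K.congrMod := ⟨zpow_mem hx n, hn⟩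
    rw [zpow_neg]
    exact (inv_mem ha).2

variable {K : Subgroup G} {x : G} (hx : x ∈ normalizer (K : Set G))

@[to_additive]
theorem mem_extendBy {a : G} : a ∈ K.extendBy hx ↔ ∃ n : ℤ, a * (x ^ n)⁻¹ ∈ K :=
  Iff.rfl

@[to_additive]
theorem le_extendBy : K ≤ K.extendBy hx :=
  fun k hk => ⟨0, by simpa using hk⟩

@[to_additive]
theorem self_mem_extendBy : x ∈ K.extendBy hx :=
  ⟨1, by simp [K.one_mem]⟩

@[to_additive]
theorem map_zpow_mul_inv_mem (hx : x ∈ normalizer (K : Set G)) {φ : G ≃* G}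
    (hφ : φ x * x⁻¹ ∈ K) (n : ℤ) : φ (x ^ n) * (x ^ n)⁻¹ ∈ K := by
  have h : (φ x, x) ∈ K.congrMod := ⟨hx, hφ⟩
  rw [map_zpow]
  exact (zpow_mem h n).2

@[to_additive]
theorem map_mem_extendBy {φ : G ≃* G} (hK : ∀ k, φ k ∈ K ↔ k ∈ K)
    (hφ : φ x * x⁻¹ ∈ K) {a : G} (ha : a ∈ K.extendBy hx) : φ a ∈ K.extendBy hx := by
  obtain ⟨n, hn⟩ := ha
  refine ⟨n, ?_⟩
  have h := K.mul_mem ((hK _).2 hn) (map_zpow_mul_inv_mem hx hφ n)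
  convert h using 1
  rw [map_mul, map_inv]
  group

@[to_additive]
theorem map_mem_extendBy_iff {φ : G ≃* G} (hK : ∀ k, φ k ∈ K ↔ k ∈ K)
    (hφ : φ x * x⁻¹ ∈ K) (a : G) : φ a ∈ K.extendBy hx ↔ a ∈ K.extendBy hx := by
  refine ⟨fun h => ?_, map_mem_extendBy hx hK hφ⟩
  have hK' : ∀ k, φ.symm k ∈ K ↔ k ∈ K := fun k => by
    rw [← hK (φ.symm k), MulEquiv.apply_symm_apply]
  have hφ' : φ.symm x * x⁻¹ ∈ K := by
    have := K.inv_mem ((hK' _).2 hφ)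
    simpa using this
  simpa using map_mem_extendBy hx hK' hφ' h

end Subgroup

theorem AddSubgroup.fg_of_le_extendBy {G : Type*} [AddGroup G] {K : AddSubgroup G} {x : G}
    (hx : x ∈ normalizer (K : Set G)) (hK : ∀ H ≤ K, H.FG) {H : AddSubgroup G}
    (hH : H ≤ K.extendBy hx) : H.FG := by
  have hmem : ∀ {a : G} {n : ℤ}, a + -(n • x) ∈ K → (a, n • x) ∈ K.congrMod :=
    fun h => ⟨zsmul_mem hx _, h⟩
  let E : AddSubgroup ℤ :=
    { carrier := {n | ∃ a ∈ H, a + -(n • x) ∈ K}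
      zero_mem' := ⟨0, H.zero_mem, by simp [K.zero_mem]⟩
      add_mem' := by
        rintro n m ⟨a, ha, hn⟩ ⟨b, hb, hm⟩
        refine ⟨a + b, H.add_mem ha hb, ?_⟩
        rw [add_zsmul]
        exact (add_mem (hmem hn) (hmem hm)).2
      neg_mem' := by
        rintro n ⟨a, ha, hn⟩
        refine ⟨-a, H.neg_mem ha, ?_⟩
        rw [neg_zsmul]
        exact (neg_mem (hmem hn)).2 }
  obtain ⟨d, hd⟩ := Int.subgroup_cyclic E
  obtain ⟨a, ha, had⟩ : d ∈ E := hd ▸ AddSubgroup.mem_closure_singleton.2 ⟨1, by simp⟩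
  have key : H = (H ⊓ K) ⊔ closure {a} := by
    apply le_antisymm
    · intro h hh
      obtain ⟨n, hn⟩ := hH hh
      have hnE : n ∈ E := ⟨h, hh, hn⟩
      rw [hd, AddSubgroup.mem_closure_singleton] at hnE
      obtain ⟨j, rfl⟩ := hnE
      have haj : j • a + -((j • d) • x) ∈ K := by
        rw [smul_eq_mul, mul_zsmul]
        exact (zsmul_mem (hmem had) j).2
      have hk : h + -(j • a) ∈ K := by
        simpa [add_assoc] using K.add_mem hn (K.neg_mem haj)
      rw [← neg_add_cancel_right h (j • a)]
      exact add_mem (mem_sup_left ⟨H.add_mem hh (H.neg_mem (H.zsmul_mem ha j)), hk⟩)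
        (mem_sup_right (mem_closure_singleton.2 ⟨j, rfl⟩))
    · exact sup_le inf_le_left ((closure_le _).2 (by simpa using ha))
  rw [key]
  exact (hK _ inf_le_right).sup ⟨{a}, by simp⟩

/-- Compatibility of the two group structures of a skew brace. -/
class IsSkewBrace (B : Type*) [AddGroup B] [Group B] : Prop where
  mul_add_eq : ∀ a b c : B, a * (b + c) = a * b + -a + a * c

namespace IsSkewBrace

variable {B : Type*} [AddGroup B] [Group B] [IsSkewBrace B]

theorem mul_zero_eq (a : B) : a * 0 = a := by
  have h := mul_add_eq a 0 0
  rw [add_zero, add_assoc, left_eq_add, neg_add_eq_zero] at h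
  exact h.symm

theorem one_eq_zero : (1 : B) = 0 := by
  rw [← one_mul (0 : B), mul_zero_eq]

/-- The automorphism `λ_a : b ↦ -a + a ∘ b` of the additive group. -/
def lambda (a : B) : B ≃+ B where
  toFun b := -a + a * b
  invFun b := a⁻¹ * (a + b)
  left_inv b := by simp
  right_inv b := by simp
  map_add' b c := by rw [mul_add_eq]; simp only [add_assoc]

theorem lambda_apply (a b : B) : lambda a b = -a + a * b := rfl

theorem mul_eq_add_lambda (a b : B) : a * b = a + lambda a b := by
  rw [lambda_apply, add_neg_cancel_left]

theorem lambda_mul (a b c : B) : lambda (a * b) c = lambda a (lambda b c) := by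
  have h : a * (b * c) = a + lambda a (b + lambda b c) := by
    rw [← mul_eq_add_lambda, ← mul_eq_add_lambda]
  rw [lambda_apply (a * b), mul_assoc, h, map_add, ← add_assoc a, ← mul_eq_add_lambda,
    neg_add_cancel_left]

theorem lambda_one (b : B) : lambda 1 b = b := by
  rw [lambda_apply, one_mul, one_eq_zero, neg_zero, zero_add]

theorem lambda_inv (a b : B) : lambda a⁻¹ b = (lambda a).symm b := by
  rw [AddEquiv.eq_symm_apply, ← lambda_mul, mul_inv_cancel, lambda_one]

theorem inv_mul_eq_lambda (a b : B) : a⁻¹ * b = lambda a⁻¹ (-a + b) := by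
  rw [lambda_inv, AddEquiv.eq_symm_apply, lambda_apply, mul_inv_cancel_left]

/-- An additive subgroup `K` is normalized by `t` when it is invariant under `λ_t` and under the
conjugations by `t` in both groups. -/
structure Normalizes (K : AddSubgroup B) (t : B) : Prop where
  lambda_mem_iff : ∀ k, lambda t k ∈ K ↔ k ∈ K
  add_conj_mem_iff : ∀ k, t + k + -t ∈ K ↔ k ∈ K
  mul_conj_mem_iff : ∀ k, t * k * t⁻¹ ∈ K ↔ k ∈ K

/-- `x` annihilates `b` modulo `K`. -/
structure AnnihilatesMod (K : Set B) (x b : B) : Prop where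
  lambda_mem : lambda x b + -b ∈ K
  add_mem : x + b + -(b + x) ∈ K
  mul_mem : x * b * (b * x)⁻¹ ∈ K

section Extension

variable {K : AddSubgroup B} {L : Subgroup B} {x : B}

theorem Normalizes.mem_addNormalizer (hx : Normalizes K x) :
    x ∈ AddSubgroup.normalizer (K : Set B) :=
  AddSubgroup.mem_normalizer_iff.2 fun k => (hx.add_conj_mem_iff k).symm

theorem Normalizes.mem_normalizer (hKL : ∀ k, k ∈ L ↔ k ∈ K) (hx : Normalizes K x) :
    x ∈ Subgroup.normalizer (L : Set B) :=
  Subgroup.mem_normalizer_iff.2 fun k => by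
    rw [hKL, hKL]; exact (hx.mul_conj_mem_iff k).symm

/-- The elements `g` for which `λ_g` preserves `K` and fixes `x` modulo `K`. -/
def lambdaFixing (K : AddSubgroup B) (x : B) : Subgroup B where
  carrier := {g | (∀ k, lambda g k ∈ K ↔ k ∈ K) ∧ lambda g x + -x ∈ K}
  one_mem' := ⟨fun k => by rw [lambda_one], by rw [lambda_one, add_neg_cancel]; exact K.zero_mem⟩
  mul_mem' := by
    rintro a b ⟨ha, ha'⟩ ⟨hb, hb'⟩
    refine ⟨fun k => by rw [lambda_mul, ha, hb], ?_⟩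
    have h := K.add_mem ((ha _).2 hb') ha'
    simpa [lambda_mul, add_assoc] using h
  inv_mem' := by
    rintro a ⟨ha, ha'⟩
    have hK : ∀ k, lambda a⁻¹ k ∈ K ↔ k ∈ K := fun k => by
      rw [← ha (lambda a⁻¹ k), lambda_inv, AddEquiv.apply_symm_apply]
    refine ⟨hK, ?_⟩
    have h := K.neg_mem ((hK _).2 ha')
    simpa [lambda_inv] using h

theorem zpow_add_neg_zsmul_mem (hx : Normalizes K x) (hxx : lambda x x + -x ∈ K) (n : ℤ) :
    x ^ n + -(n • x) ∈ K := by
  have hfix : ∀ n : ℤ, lambda (x ^ n) x + -x ∈ K := fun n =>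
    (zpow_mem (show x ∈ lambdaFixing K x from ⟨hx.lambda_mem_iff, hxx⟩) n).2
  have step : ∀ n : ℤ, x ^ (n + 1) + -((n + 1) • x) =
      (x ^ n + -(n • x)) + (n • x + (lambda (x ^ n) x + -x) + -(n • x)) := fun n => by
    rw [zpow_add_one, mul_eq_add_lambda, add_zsmul, one_zsmul, neg_add_rev]
    simp only [add_assoc, neg_add_cancel_left]
  have hmem : ∀ n : ℤ, n • x + (lambda (x ^ n) x + -x) + -(n • x) ∈ K := fun n =>
    (AddSubgroup.mem_normalizer_iff.1 (zsmul_mem hx.mem_addNormalizer n) _).1 (hfix n)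
  induction n using Int.induction_on with
  | zero => simp [one_eq_zero, K.zero_mem]
  | succ n ih => rw [step]; exact K.add_mem ih (hmem _)
  | pred n ih =>
    have h := step (-n - 1)
    rw [sub_add_cancel] at h
    rw [h] at ih
    exact (K.add_mem_cancel_right (hmem _)).1 ih

theorem mem_extendBy_iff (hKL : ∀ k, k ∈ L ↔ k ∈ K) (hx : Normalizes K x)
    (hxx : lambda x x + -x ∈ K) (a : B) :
    a ∈ L.extendBy (hx.mem_normalizer hKL) ↔ a ∈ K.extendBy hx.mem_addNormalizer := by
  rw [Subgroup.mem_extendBy, AddSubgroup.mem_extendBy]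
  refine exists_congr fun n => ?_
  have hn := zpow_add_neg_zsmul_mem hx hxx n
  have hnorm : x ^ n ∈ AddSubgroup.normalizer (K : Set B) := by
    have := add_mem (AddSubgroup.le_normalizer hn) (zsmul_mem hx.mem_addNormalizer n)
    simpa using this
  have hlam : x⁻¹ ^ n ∈ lambdaFixing K x :=
    zpow_mem (inv_mem (show x ∈ lambdaFixing K x from ⟨hx.lambda_mem_iff, hxx⟩)) n
  have e1 : a + -(n • x) = (a + -(x ^ n)) + (x ^ n + -(n • x)) := by simp [add_assoc]
  have e2 : a * (x ^ n)⁻¹ = x ^ n * ((x ^ n)⁻¹ * a) * (x ^ n)⁻¹ := by group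
  have e3 : -(x ^ n) + a = -(x ^ n) + (a + -(x ^ n)) + x ^ n := by simp [add_assoc]
  rw [e1, K.add_mem_cancel_right hn,
    show a + -(x ^ n) ∈ K ↔ -(x ^ n) + a ∈ K by
      rw [e3]; exact AddSubgroup.mem_normalizer_iff''.1 hnorm _,
    e2]
  refine (Subgroup.mem_normalizer_iff.1 (zpow_mem (hx.mem_normalizer hKL) n) _).symm.trans ?_
  rw [hKL, inv_mul_eq_lambda, ← inv_zpow]
  exact hlam.1 _

theorem Normalizes.extendBy {t : B} (hKL : ∀ k, k ∈ L ↔ k ∈ K) (hx : Normalizes K x)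
    (hxx : lambda x x + -x ∈ K) (ht : Normalizes K t) (hxt : AnnihilatesMod (K : Set B) x t) :
    Normalizes (K.extendBy hx.mem_addNormalizer) t where
  lambda_mem_iff := by
    refine AddSubgroup.map_mem_extendBy_iff hx.mem_addNormalizer ht.lambda_mem_iff ?_
    obtain ⟨k, hk, htx⟩ : ∃ k ∈ K, t * x = x * t * k := by
      refine ⟨(x * t)⁻¹ * (t * x), ?_, by group⟩
      have h := (Subgroup.mem_normalizer_iff''.1
        (mul_mem (hx.mem_normalizer hKL) (ht.mem_normalizer hKL)) _).1
        (L.inv_mem ((hKL _).2 hxt.mul_mem))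
      rw [← hKL]
      simpa [mul_assoc] using h
    have hk' : lambda (x * t) k ∈ K := by
      rwa [lambda_mul, hx.lambda_mem_iff, ht.lambda_mem_iff]
    have hcomm := K.neg_mem hxt.add_mem
    have h1 := (AddSubgroup.mem_normalizer_iff''.1 ht.mem_addNormalizer _).1 hcomm
    have h2 := (AddSubgroup.mem_normalizer_iff''.1
      (add_mem ht.mem_addNormalizer (neg_mem hx.mem_addNormalizer)) _).1 hxt.lambda_mem
    have h3 := (AddSubgroup.mem_normalizer_iff.1 hx.mem_addNormalizer _).1 hk'
    have h := K.add_mem (K.add_mem (K.neg_mem h1) h2) h3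
    rw [lambda_apply, htx, mul_eq_add_lambda (x * t)]
    nth_rw 1 [mul_eq_add_lambda x t]
    simpa [add_assoc] using h
  add_conj_mem_iff := by
    refine AddSubgroup.map_mem_extendBy_iff hx.mem_addNormalizer
      (φ := AddAut.addConj t) ht.add_conj_mem_iff ?_
    simpa [add_assoc] using K.neg_mem hxt.add_mem
  mul_conj_mem_iff := fun a => by
    rw [← mem_extendBy_iff hKL hx hxx, ← mem_extendBy_iff hKL hx hxx]
    refine Subgroup.map_mem_extendBy_iff (hx.mem_normalizer hKL)
      (φ := MulAut.conj t) (fun k => ?_) ?_ a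
    · rw [hKL, hKL]
      exact ht.mul_conj_mem_iff k
    · simpa [mul_assoc] using L.inv_mem ((hKL _).2 hxt.mul_mem)

end Extension

/-- A set is tame when, for every finite `T`, it is contained in a sub-skew brace normalized by `T`
whose additive subgroups are all finitely generated. -/
def Tame (X : Set B) : Prop :=
  ∀ T : Set B, T.Finite → ∃ (K : AddSubgroup B) (L : Subgroup B), (∀ k, k ∈ L ↔ k ∈ K) ∧
    X ⊆ K ∧ (∀ H ≤ K, H.FG) ∧ ∀ t ∈ T, Normalizes K t

theorem Tame.mono {X Y : Set B} (hY : Tame Y) (h : X ⊆ Y) : Tame X := fun T hT =>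
  let ⟨K, L, hKL, hYK, hfg, hn⟩ := hY T hT
  ⟨K, L, hKL, h.trans hYK, hfg, hn⟩

theorem tame_empty : Tame (∅ : Set B) := fun _ _ =>
  ⟨⊥, ⊥, fun k => by rw [Subgroup.mem_bot, AddSubgroup.mem_bot, one_eq_zero],
    Set.empty_subset _, fun H hH => by rw [le_bot_iff.1 hH]; exact AddSubgroup.FG.bot,
    fun t _ =>
      { lambda_mem_iff := fun k => by simp
        add_conj_mem_iff := fun k => by simp [add_neg_eq_zero]
        mul_conj_mem_iff := fun k => by simp [← one_eq_zero] }⟩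

/-- The elements which may be adjoined to any tame set. -/
def tameElements (B : Type*) [AddGroup B] [Group B] [IsSkewBrace B] : Set B :=
  {x | ∀ X : Set B, Tame X → Tame (insert x X)}

theorem Tame.union {X F : Set B} (hX : Tame X) (hF : F.Finite) (hFt : F ⊆ tameElements B) :
    Tame (F ∪ X) := by
  induction F, hF using Set.Finite.induction_on with
  | empty => simpa using hX
  | insert _ _ ih =>
    rw [Set.insert_union]
    exact hFt (Set.mem_insert _ _) _ (ih ((Set.subset_insert _ _).trans hFt))

theorem tame_of_finite {F : Set B} (hF : F.Finite) (hFt : F ⊆ tameElements B) : Tame F := by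
  simpa using tame_empty.union hF hFt

theorem zero_mem_tameElements : (0 : B) ∈ tameElements B := fun _ hX T hT =>
  let ⟨K, L, hKL, hXK, hfg, hn⟩ := hX T hT
  ⟨K, L, hKL, Set.insert_subset K.zero_mem hXK, hfg, hn⟩

theorem mem_tameElements_of_annihilatesMod {x : B}
    (hx : ∀ b, AnnihilatesMod (tameElements B) x b) : x ∈ tameElements B := by
  intro X hX T hT
  have hT' : (insert x T).Finite := hT.insert x
  let F : Set B := (fun b => lambda x b + -b) '' insert x T ∪
    (fun b => x + b + -(b + x)) '' insert x T ∪ (fun b => x * b * (b * x)⁻¹) '' insert x T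
  have hF : F.Finite := ((hT'.image _).union (hT'.image _)).union (hT'.image _)
  have hFt : F ⊆ tameElements B := by
    rintro _ ((⟨b, -, rfl⟩ | ⟨b, -, rfl⟩) | ⟨b, -, rfl⟩)
    exacts [(hx b).lambda_mem, (hx b).add_mem, (hx b).mul_mem]
  obtain ⟨K, L, hKL, hFX, hfg, hn⟩ := hX.union hF hFt _ hT'
  have hF' : ∀ b ∈ insert x T, AnnihilatesMod (K : Set B) x b := fun b hb =>
    { lambda_mem := hFX (Or.inl (Or.inl (Or.inl ⟨b, hb, rfl⟩)))
      add_mem := hFX (Or.inl (Or.inl (Or.inr ⟨b, hb, rfl⟩)))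
      mul_mem := hFX (Or.inl (Or.inr ⟨b, hb, rfl⟩)) }
  have hxn := hn x (Set.mem_insert _ _)
  have hxx := (hF' x (Set.mem_insert _ _)).lambda_mem
  refine ⟨K.extendBy hxn.mem_addNormalizer, L.extendBy (hxn.mem_normalizer hKL),
    mem_extendBy_iff hKL hxn hxx, Set.insert_subset (AddSubgroup.self_mem_extendBy _) ?_,
    fun H hH => AddSubgroup.fg_of_le_extendBy _ hfg hH,
    fun t ht => Normalizes.extendBy hKL hxn hxx (hn t (Set.mem_insert_of_mem _ ht))
      (hF' t (Set.mem_insert_of_mem _ ht))⟩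
  exact (Set.subset_union_right.trans hFX).trans (AddSubgroup.le_extendBy hxn.mem_addNormalizer)

end IsSkewBrace

theorem AddSubgroup.exists_forall_eq_of_fg {G : Type*} [AddGroup G] {K : AddSubgroup G}
    (hK : ∀ H ≤ K, H.FG) {f : ℕ → AddSubgroup G} (hf : Monotone f) (hfK : ∀ n, f n ≤ K) :
    ∃ n, ∀ m, n ≤ m → f m = f n := by
  obtain ⟨S, hS⟩ := hK _ (iSup_le hfK)
  have hmem : ∀ s ∈ S, ∃ n, s ∈ f n := fun s hs => by
    rw [← mem_iSup_of_directed hf.directed_le, ← hS]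
    exact subset_closure hs
  choose! g hg using hmem
  refine ⟨S.sup g, fun m hm => (hf hm).antisymm' ?_⟩
  refine (le_iSup f m).trans ?_
  rw [← hS, closure_le]
  exact fun s hs => hf (Finset.le_sup hs) (hg s hs)

namespace SkewBrace

variable {B : Type u}

/-- The additive group of a skew brace. -/
abbrev addGroup (S : SkewBrace B) : AddGroup B where
  add := S.add
  zero := S.zero
  neg := S.neg
  add_assoc := S.add_assoc
  zero_add := S.zero_add
  add_zero := S.add_zero
  neg_add_cancel := S.neg_add
  nsmul := @nsmulRec B ⟨S.zero⟩ ⟨S.add⟩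
  zsmul := @zsmulRec B ⟨S.zero⟩ ⟨S.add⟩ ⟨S.neg⟩ (@nsmulRec B ⟨S.zero⟩ ⟨S.add⟩)

/-- The multiplicative group of a skew brace. -/
abbrev group (S : SkewBrace B) : Group B where
  mul := S.mul
  one := S.zero
  inv := S.inv
  mul_assoc := S.mul_assoc
  one_mul := S.zero_mul
  mul_one := S.mul_zero
  inv_mul_cancel := S.inv_mul

theorem isSkewBrace (S : SkewBrace B) :
    letI := S.addGroup
    letI := S.group
    IsSkewBrace B :=
  letI := S.addGroup
  letI := S.group
  ⟨S.compat⟩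

theorem annStep_mono (S : SkewBrace B) {I J : Set B} (h : I ⊆ J) : S.annStep I ⊆ S.annStep J :=
  fun _ hx => ⟨fun b => h (hx.1 b), fun b => h (hx.2.1 b), fun b => h (hx.2.2 b)⟩

theorem annSeries_subset (S : SkewBrace B) {I : Set B} (h0 : S.zero ∈ I) (hI : S.annStep I ⊆ I)
    (o : Ordinal.{v}) : S.annSeries o ⊆ I := by
  induction o using Ordinal.limitRecOn with
  | zero => simpa [annSeries] using h0
  | add_one o ih =>
    rw [annSeries, Ordinal.limitRecOn_add_one]
    exact (S.annStep_mono ih).trans hI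
  | limit o ho ih =>
    rw [annSeries, Ordinal.limitRecOn_limit _ _ _ _ ho]
    exact Set.iUnion₂_subset ih

end SkewBrace

/-- **Theorem.** Let `B` be an annihilator hypercentral skew brace (i.e.
`B = Ann_λ(B)` for some ordinal `λ`). Then every finitely generated sub-skew brace
of `B` satisfies the ascending chain condition on sub-skew braces. -/
theorem acc_of_annihilator_hypercentral {B : Type u} (S : SkewBrace B)
    (hhc : ∃ o : Ordinal.{u}, S.annSeries o = Set.univ) :
    ∀ C : Set B, S.IsSub C → (∃ T : Finset B, ↑T ⊆ C ∧ S.subGen ↑T = C) →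
      ∀ f : ℕ → Set B, Monotone f → (∀ n, S.IsSub (f n) ∧ f n ⊆ C) →
        ∃ n, ∀ m, n ≤ m → f m = f n := by
  obtain ⟨o, ho⟩ := hhc
  rintro C - ⟨T, -, rfl⟩ f hf hfC
  let _ := S.addGroup
  let _ := S.group
  have _ : IsSkewBrace B := S.isSkewBrace
  have htame : Set.univ ⊆ IsSkewBrace.tameElements B := by
    rw [← ho]
    refine S.annSeries_subset IsSkewBrace.zero_mem_tameElements (fun x hx => ?_) o
    exact IsSkewBrace.mem_tameElements_of_annihilatesMod fun b =>
      ⟨hx.1 b, hx.2.1 b, hx.2.2 b⟩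
  obtain ⟨K, L, hKL, hTK, hfg, -⟩ := IsSkewBrace.tame_of_finite T.finite_toSet
    ((Set.subset_univ _).trans htame) ∅ Set.finite_empty
  have hK : S.IsSub (K : Set B) :=
    ⟨K.zero_mem, fun _ ha _ hb => K.add_mem ha hb, fun _ ha => K.neg_mem ha,
      fun _ ha _ hb => (hKL _).1 (L.mul_mem ((hKL _).2 ha) ((hKL _).2 hb)),
      fun _ ha => (hKL _).1 (L.inv_mem ((hKL _).2 ha))⟩
  let g : ℕ → AddSubgroup B := fun n =>
    { carrier := f n
      zero_mem' := (hfC n).1.1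
      add_mem' := fun ha hb => (hfC n).1.2.1 _ ha _ hb
      neg_mem' := fun ha => (hfC n).1.2.2.1 _ ha }
  obtain ⟨n, hn⟩ := AddSubgroup.exists_forall_eq_of_fg hfg (f := g) (fun _ _ h => hf h)
    (fun n => (hfC n).2.trans (Set.sInter_subset_of_mem ⟨hK, hTK⟩))
  exact ⟨n, fun m hm => congrArg (fun H : AddSubgroup B => (H : Set B)) (hn m hm)⟩
end
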